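/- No map projection sends all spherical caps to discs while preserving equality of areas: there is no homeomorphism φ from a nonempty open subset U of S² (with the subspace topology) onto an open subset V of EuclideanSpace ℝ (Fin 2) such that both of the following hold: (i) for every spherical cap κ with κ ⊆ U, the image φ '' κ is an open Euclidean disc (an open metric ball of positive radius in the plane), and for every open disc D with D ⊆ V, the preimage φ⁻¹ '' D is a spherical cap; (ii) there is a nonempty spherical cap κ₀ with κ₀ ⊆ U such that for all Borel sets A, B ⊆ κ₀ with μH²(A) = μH²(B) one has vol(φ '' A) = vol(φ '' B), and for all Borel sets A′, B′ ⊆ φ '' κ₀ with vol(A′) = vol(B′) one has μH²(φ⁻¹ '' A′) = μH²(φ⁻¹ '' B′). (This is the theorem showing no map projection can preserve the Reock compactness score ordering.) -/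

import Mathlib

open Metric MeasureTheory
open scoped RealInnerProductSpace

/-- A *spherical cap*: the set of points of the unit sphere on one (open) side of a plane
cutting through the sphere. -/
def IsSphericalCap (κ : Set (EuclideanSpace ℝ (Fin 3))) : Prop :=
  ∃ (v : EuclideanSpace ℝ (Fin 3)) (c : ℝ), ‖v‖ = 1 ∧ -1 < c ∧ c < 1 ∧
    κ = {p : EuclideanSpace ℝ (Fin 3) |
      p ∈ sphere (0 : EuclideanSpace ℝ (Fin 3)) 1 ∧ c < ⟪p, v⟫}

/-- The open spherical cap with centre `v` and height `c`. -/
def sphericalCap (v : EuclideanSpace ℝ (Fin 3)) (c : ℝ) : Set (EuclideanSpace ℝ (Fin 3)) :=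
  {p | p ∈ sphere (0 : EuclideanSpace ℝ (Fin 3)) 1 ∧ c < ⟪p, v⟫}

theorem mem_sphericalCap {v p : EuclideanSpace ℝ (Fin 3)} {c : ℝ} :
    p ∈ sphericalCap v c ↔ ‖p‖ = 1 ∧ c < ⟪p, v⟫ := by
  simp [sphericalCap]

theorem measurableSet_sphericalCap (v : EuclideanSpace ℝ (Fin 3)) (c : ℝ) :
    MeasurableSet (sphericalCap v c) :=
  isClosed_sphere.measurableSet.inter
    (isOpen_lt (f := fun _ => c) (g := fun p => ⟪p, v⟫) (by fun_prop) (by fun_prop)).measurableSet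

theorem hausdorffMeasure_sphericalCap_eq {v w : EuclideanSpace ℝ (Fin 3)} (h : ‖v‖ = ‖w‖)
    (c : ℝ) : μH[2] (sphericalCap v c) = μH[2] (sphericalCap w c) := by
  have hf := Submodule.reflection_sub h
  set f := (Submodule.span ℝ {v - w})ᗮ.reflection
  have hpre : sphericalCap v c = f.toIsometryEquiv ⁻¹' sphericalCap w c := by
    ext p
    simp only [Set.mem_preimage, mem_sphericalCap, LinearIsometryEquiv.coe_toIsometryEquiv,
      f.norm_map]
    rw [← hf, f.inner_map_map]
  rw [hpre, f.toIsometryEquiv.hausdorffMeasure_preimage]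

theorem exists_norm_eq_one_inner_eq_zero (v : EuclideanSpace ℝ (Fin 3)) :
    ∃ u : EuclideanSpace ℝ (Fin 3), ‖u‖ = 1 ∧ ⟪u, v⟫ = 0 := by
  have hne : (Submodule.span ℝ {v})ᗮ ≠ ⊥ := by
    intro h
    have h1 := Submodule.finrank_add_finrank_orthogonal (Submodule.span ℝ {v})
    have h2 := finrank_span_le_card (R := ℝ) ({v} : Set (EuclideanSpace ℝ (Fin 3)))
    rw [h, finrank_bot, finrank_euclideanSpace_fin] at h1
    rw [Set.toFinset_singleton, Finset.card_singleton] at h2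
    omega
  obtain ⟨u, hu, hu0⟩ := Submodule.exists_mem_ne_zero_of_ne_bot hne
  refine ⟨(‖u‖⁻¹ : ℝ) • u, norm_smul_inv_norm hu0, ?_⟩
  rw [real_inner_smul_left, Submodule.mem_orthogonal_singleton_iff_inner_left.mp hu, mul_zero]

theorem exists_norm_eq_one_inner_eq {v : EuclideanSpace ℝ (Fin 3)} (hv : ‖v‖ = 1) {c : ℝ}
    (h₁ : -1 ≤ c) (h₂ : c ≤ 1) : ∃ p : EuclideanSpace ℝ (Fin 3), ‖p‖ = 1 ∧ ⟪p, v⟫ = c := by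
  obtain ⟨u, hu, huv⟩ := exists_norm_eq_one_inner_eq_zero v
  refine ⟨c • v + √(1 - c ^ 2) • u, ?_, ?_⟩
  · rw [← sq_eq_sq₀ (norm_nonneg _) zero_le_one, norm_add_sq_real, norm_smul, norm_smul, hu, hv,
      real_inner_smul_left, real_inner_smul_right, real_inner_comm, huv, mul_pow, mul_pow,
      Real.norm_eq_abs, Real.norm_eq_abs, sq_abs, sq_abs, Real.sq_sqrt (by nlinarith)]
    ring
  · rw [inner_add_left, real_inner_smul_left, real_inner_smul_left, huv,
      real_inner_self_eq_norm_sq, hv]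
    ring

/-- Two disjoint caps of the same height that touch have centres at a distance determined by the
height. -/
theorem inner_centers_of_tangent_caps {v w p : EuclideanSpace ℝ (Fin 3)} {c : ℝ} (hv : ‖v‖ = 1)
    (hw : ‖w‖ = 1) (hdisj : Disjoint (sphericalCap v c) (sphericalCap w c)) (hp : ‖p‖ = 1)
    (hpv : c ≤ ⟪p, v⟫) (hpw : c ≤ ⟪p, w⟫) : ⟪v, w⟫ = 2 * c ^ 2 - 1 := by
  have hsq : ‖v + w‖ ^ 2 = 2 + 2 * ⟪v, w⟫ := by
    rw [norm_add_sq_real, hv, hw]; ring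
  have hout : ∀ q, ‖q‖ = 1 → c < ⟪q, v⟫ → ⟪q, w⟫ ≤ c := fun q hq hqv => by
    by_contra! hqw
    exact Set.disjoint_left.mp hdisj (mem_sphericalCap.mpr ⟨hq, hqv⟩)
      (mem_sphericalCap.mpr ⟨hq, hqw⟩)
  have hle : 2 * c ≤ ‖v + w‖ := by
    have := real_inner_le_norm p (v + w)
    rw [hp, inner_add_right] at this
    linarith
  suffices ‖v + w‖ = 2 * c by rw [this] at hsq; linarith
  refine le_antisymm ?_ hle
  by_contra! hlt
  by_cases h0 : v + w = 0
  · obtain ⟨u, hu, huv⟩ := exists_norm_eq_one_inner_eq_zero v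
    rw [h0, norm_zero] at hlt
    have := hout u hu (by linarith)
    rw [eq_neg_of_add_eq_zero_right h0, inner_neg_right, huv] at this
    linarith
  · have hpos : 0 < ‖v + w‖ := norm_pos_iff.mpr h0
    have hmul : ‖v + w‖⁻¹ * (‖v + w‖ ^ 2 / 2) = ‖v + w‖ / 2 := by field_simp
    have hmv : ⟪(‖v + w‖⁻¹ : ℝ) • (v + w), v⟫ = ‖v + w‖ / 2 := by
      rw [real_inner_smul_left, ← hmul, hsq, inner_add_left, real_inner_self_eq_norm_sq, hv,
        real_inner_comm]
      ring
    have hmw : ⟪(‖v + w‖⁻¹ : ℝ) • (v + w), w⟫ = ‖v + w‖ / 2 := by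
      rw [real_inner_smul_left, ← hmul, hsq, inner_add_left, real_inner_self_eq_norm_sq, hw]
      ring
    have := hout _ (norm_smul_inv_norm h0) (hmv.symm ▸ (by linarith : c < ‖v + w‖ / 2))
    exact absurd (hmw.symm.trans_le this) (by linarith)

/-- Two distinct unit vectors with the same inner product `a` with two independent unit vectors,
which also have inner product `a`, are mirror images in the plane of the latter. -/
theorem add_eq_smul_add_of_inner_eq {a : ℝ} {A B C D : EuclideanSpace ℝ (Fin 3)} (hA : ‖A‖ = 1)
    (hB : ‖B‖ = 1) (hC : ‖C‖ = 1) (hD : ‖D‖ = 1) (hAB : ⟪A, B⟫ = a) (hAC : ⟪A, C⟫ = a)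
    (hBC : ⟪B, C⟫ = a) (hAD : ⟪A, D⟫ = a) (hBD : ⟪B, D⟫ = a) (hne : C ≠ D) (ha : 1 + a ≠ 0)
    (ha' : a ≠ 1) : C + D = (2 * a / (1 + a)) • (A + B) := by
  have hAA : ⟪A, A⟫ = 1 := by rw [real_inner_self_eq_norm_sq, hA]; norm_num
  have hBB : ⟪B, B⟫ = 1 := by rw [real_inner_self_eq_norm_sq, hB]; norm_num
  have hCC : ⟪C, C⟫ = 1 := by rw [real_inner_self_eq_norm_sq, hC]; norm_num
  have hDD : ⟪D, D⟫ = 1 := by rw [real_inner_self_eq_norm_sq, hD]; norm_num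
  have hNN : ⟪C - D, C - D⟫ ≠ 0 := by rw [inner_self_ne_zero]; exact sub_ne_zero.mpr hne
  have hAN : ⟪A, C - D⟫ = 0 := by rw [inner_sub_right, hAC, hAD, sub_self]
  have hBN : ⟪B, C - D⟫ = 0 := by rw [inner_sub_right, hBC, hBD, sub_self]
  have hBA : ⟪B, A⟫ = a := by rw [real_inner_comm, hAB]
  have hli : LinearIndependent ℝ ![A, B, C - D] := by
    rw [Fintype.linearIndependent_iff]
    intro g hg
    simp only [Fin.sum_univ_three, Matrix.cons_val] at hg
    have e1 := congrArg (fun x => ⟪A, x⟫) hg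
    have e2 := congrArg (fun x => ⟪B, x⟫) hg
    have e3 := congrArg (fun x => ⟪x, C - D⟫) hg
    simp only [inner_add_right, inner_add_left, real_inner_smul_right, real_inner_smul_left, hAA,
      hBB, hAB, hBA, hAN, hBN, inner_zero_right, inner_zero_left] at e1 e2 e3
    have hdet : (1 + a) * (1 - a) ≠ 0 := mul_ne_zero ha (sub_ne_zero.mpr ha'.symm)
    have g2 : g 2 = 0 := by simpa [sub_ne_zero.mpr hne] using e3
    have g0 : g 0 = 0 := (mul_eq_zero.mp (by linear_combination e1 - a * e2 :
      (1 + a) * (1 - a) * g 0 = 0)).resolve_left hdet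
    have g1 : g 1 = 0 := (mul_eq_zero.mp (by linear_combination e2 - a * e1 :
      (1 + a) * (1 - a) * g 1 = 0)).resolve_left hdet
    intro i
    fin_cases i <;> assumption
  have hspan := hli.span_eq_top_of_card_eq_finrank (by simp)
  rw [← sub_eq_zero]
  refine (Submodule.mem_bot ℝ).mp ?_
  rw [← Submodule.top_orthogonal_eq_bot, ← hspan, Submodule.mem_orthogonal]
  intro u hu
  induction hu using Submodule.span_induction with
  | zero => simp
  | add x y _ _ hx hy => rw [inner_add_left, hx, hy, add_zero]
  | smul t x _ hx => rw [real_inner_smul_left, hx, mul_zero]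
  | mem x hx =>
    obtain ⟨i, rfl⟩ := hx
    fin_cases i
    · simp only [Matrix.cons_val, Fin.zero_eta, inner_sub_right, inner_add_right,
        real_inner_smul_right, hAA, hAB, hAC, hAD]
      field_simp; ring
    · simp only [Matrix.cons_val, Fin.mk_one, inner_sub_right, inner_add_right,
        real_inner_smul_right, hBB, hBA, hBC, hBD]
      field_simp; ring
    · simp only [Matrix.cons_val, Fin.reduceFinMk, inner_sub_right, inner_add_right,
        real_inner_smul_right, real_inner_comm A, real_inner_comm B, hAN, hBN]
      rw [inner_sub_left, inner_sub_left, hCC, hDD, real_inner_comm D C]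
      ring

/-- Six points of the sphere around a seventh cannot form six equilateral triangles. -/
theorem not_equilateral_hexagon {a : ℝ} {o v₁ v₂ v₃ v₄ v₅ v₆ : EuclideanSpace ℝ (Fin 3)}
    (ho : ‖o‖ = 1) (h₁ : ‖v₁‖ = 1) (h₂ : ‖v₂‖ = 1) (h₃ : ‖v₃‖ = 1) (h₄ : ‖v₄‖ = 1)
    (h₅ : ‖v₅‖ = 1) (h₆ : ‖v₆‖ = 1) (ho₁ : ⟪o, v₁⟫ = a) (ho₂ : ⟪o, v₂⟫ = a) (ho₃ : ⟪o, v₃⟫ = a)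
    (ho₄ : ⟪o, v₄⟫ = a) (ho₅ : ⟪o, v₅⟫ = a) (ho₆ : ⟪o, v₆⟫ = a) (h₁₂ : ⟪v₁, v₂⟫ = a)
    (h₂₃ : ⟪v₂, v₃⟫ = a) (h₃₄ : ⟪v₃, v₄⟫ = a) (h₄₅ : ⟪v₄, v₅⟫ = a) (h₅₆ : ⟪v₅, v₆⟫ = a)
    (h₆₁ : ⟪v₆, v₁⟫ = a) (no : o ≠ v₁) (n₁₂ : v₁ ≠ v₂) (n₁₃ : v₁ ≠ v₃) (n₂₄ : v₂ ≠ v₄)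
    (n₄₆ : v₄ ≠ v₆) (n₅₁ : v₅ ≠ v₁) (n₆₂ : v₆ ≠ v₂) (n₁₄ : v₁ ≠ v₄) : False := by
  have ha' : a ≠ 1 := fun h => no ((inner_eq_one_iff_of_norm_eq_one ho h₁).mp (ho₁.trans h))
  have ha : 1 + a ≠ 0 := fun h => by
    have e₁ := (inner_eq_neg_one_iff_of_norm_eq_one ho h₁).mp (ho₁.trans (by linarith))
    have e₂ := (inner_eq_neg_one_iff_of_norm_eq_one ho h₂).mp (ho₂.trans (by linarith))
    exact n₁₂ (neg_injective (e₁.symm.trans e₂))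
  have flip : ∀ {x y : EuclideanSpace ℝ (Fin 3)}, ⟪x, y⟫ = a → ⟪y, x⟫ = a := fun h => by
    rw [real_inner_comm, h]
  have r₂ := add_eq_smul_add_of_inner_eq ho h₂ h₁ h₃ ho₂ ho₁ (flip h₁₂) ho₃ h₂₃ n₁₃ ha ha'
  have r₃ := add_eq_smul_add_of_inner_eq ho h₃ h₂ h₄ ho₃ ho₂ (flip h₂₃) ho₄ h₃₄ n₂₄ ha ha'
  have r₅ := add_eq_smul_add_of_inner_eq ho h₅ h₄ h₆ ho₅ ho₄ (flip h₄₅) ho₆ h₅₆ n₄₆ ha ha'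
  have r₆ := add_eq_smul_add_of_inner_eq ho h₆ h₅ h₁ ho₆ ho₅ (flip h₅₆) ho₁ h₆₁ n₅₁ ha ha'
  have r₁ := add_eq_smul_add_of_inner_eq ho h₁ h₆ h₂ ho₁ ho₆ (flip h₆₁) ho₂ h₁₂ n₆₂ ha ha'
  set s := 2 * a / (1 + a) with hs
  have hsa : s * (1 + a) = 2 * a := by rw [hs]; field_simp
  have key : (s ^ 2 - 1) • (v₂ - v₆) = 0 := by
    have e₃ : v₃ = s • (o + v₂) - v₁ := by rw [← r₂]; abel
    have e₄ : v₄ = s • (o + v₃) - v₂ := by rw [← r₃]; abel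
    have e₆ : v₆ = s • (o + v₁) - v₂ := by rw [← r₁]; abel
    have e₅ : v₅ = s • (o + v₆) - v₁ := by rw [← r₆]; abel
    have e₄' : v₄ = s • (o + v₅) - v₆ := by rw [← r₅]; abel
    rw [e₅, e₆] at e₄'
    rw [e₃] at e₄
    rw [e₆]
    have := e₄.symm.trans e₄'
    linear_combination (norm := module) this
  rcases smul_eq_zero.mp key with h | h
  · have hs1 : (s - 1) * (s + 1) = 0 := by linear_combination h
    rcases mul_eq_zero.mp hs1 with h | h
    · exact ha' (by linear_combination (a + 1) * h - hsa)
    · apply n₁₄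
      have hsm : s = -1 := by linarith
      rw [hsm] at r₂ r₃
      linear_combination (norm := module) r₂ - r₃
  · exact n₆₂ (sub_eq_zero.mp h).symm

theorem eq_of_ball_subset_ball {E : Type*} [NormedAddCommGroup E] [NormedSpace ℝ E] {x y : E}
    {r : ℝ} (hr : 0 < r) (h : ball y r ⊆ ball x r) : y = x := by
  by_contra hne
  have hd : 0 < ‖y - x‖ := norm_pos_iff.mpr (sub_ne_zero.mpr hne)
  have hcl := closure_mono h
  rw [closure_ball _ hr.ne', closure_ball _ hr.ne'] at hcl
  have hz : y + (r / ‖y - x‖) • (y - x) ∈ closedBall y r := by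
    simp [norm_smul, abs_of_pos hr, hd.ne']
  have hzx := hcl hz
  have heq : y + (r / ‖y - x‖) • (y - x) - x = (1 + r / ‖y - x‖) • (y - x) := by module
  rw [mem_closedBall, dist_eq_norm, heq, norm_smul, Real.norm_of_nonneg (by positivity), add_mul,
    div_mul_cancel₀ _ hd.ne'] at hzx
  linarith

theorem ball_eq_ball_of_subset_of_volume_eq {x y : EuclideanSpace ℝ (Fin 2)} {r s : ℝ}
    (hr : 0 < r) (hs : 0 < s) (h : ball y s ⊆ ball x r)
    (hvol : volume (ball y s) = volume (ball x r)) : ball y s = ball x r := by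
  have hsr : s = r := by
    rw [EuclideanSpace.volume_ball_fin_two, EuclideanSpace.volume_ball_fin_two] at hvol
    have hpi : ENNReal.ofReal Real.pi ≠ 0 := by simp [Real.pi_pos]
    rw [ENNReal.mul_left_inj hpi ENNReal.ofReal_ne_top] at hvol
    have := (ENNReal.pow_right_strictMono two_ne_zero).injective hvol
    exact (ENNReal.ofReal_eq_ofReal_iff hs.le hr.le).mp this
  subst hsr
  rw [eq_of_ball_subset_ball hr h]

/-- If `φ` sends the caps in `κ₀` to discs and preserves equality of areas in `κ₀`, then a cap
in `κ₀` is at most as high as any other one that is sent to a disc of the same radius. -/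
theorem height_le_of_image_eq_ball {κ₀ : Set (EuclideanSpace ℝ (Fin 3))}
    {φ : EuclideanSpace ℝ (Fin 3) → EuclideanSpace ℝ (Fin 2)} (hinj : Set.InjOn φ κ₀)
    (hdisc : ∀ κ, IsSphericalCap κ → κ ⊆ κ₀ →
      ∃ (x : EuclideanSpace ℝ (Fin 2)) (r : ℝ), 0 < r ∧ φ '' κ = ball x r)
    (harea : ∀ A B : Set (EuclideanSpace ℝ (Fin 3)), A ⊆ κ₀ → B ⊆ κ₀ → MeasurableSet A →
      MeasurableSet B → μH[2] A = μH[2] B → volume (φ '' A) = volume (φ '' B))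
    {v w : EuclideanSpace ℝ (Fin 3)} {c d r : ℝ} {x y : EuclideanSpace ℝ (Fin 2)}
    (hv : ‖v‖ = 1) (hw : ‖w‖ = 1) (hc : -1 < c) (hd : d < 1) (hr : 0 < r)
    (hvκ : sphericalCap v c ⊆ κ₀) (hwκ : sphericalCap w d ⊆ κ₀)
    (hvx : φ '' sphericalCap v c = ball x r) (hwy : φ '' sphericalCap w d = ball y r) :
    d ≤ c := by
  by_contra! hcd
  have hsub : sphericalCap v d ⊆ sphericalCap v c := fun p hp => ⟨hp.1, hcd.trans hp.2⟩
  obtain ⟨z, s, hs, hz⟩ := hdisc (sphericalCap v d) ⟨v, d, hv, by linarith, hd, rfl⟩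
    (hsub.trans hvκ)
  have hvol := harea _ _ (hsub.trans hvκ) hwκ (measurableSet_sphericalCap v d)
    (measurableSet_sphericalCap w d) (hausdorffMeasure_sphericalCap_eq (hv.trans hw.symm) d)
  rw [hz, hwy, EuclideanSpace.volume_ball_fin_two y, ← EuclideanSpace.volume_ball_fin_two x]
    at hvol
  have himg := Set.image_mono (f := φ) hsub
  rw [hz, hvx] at himg
  have hball := ball_eq_ball_of_subset_of_volume_eq hr hs himg hvol
  rw [← hz, ← hvx] at hball
  obtain ⟨p, hp, hpv⟩ := exists_norm_eq_one_inner_eq hv (by linarith : -1 ≤ d) hd.le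
  have hp' : p ∈ sphericalCap v d := by
    rw [(hinj.image_eq_image_iff (hsub.trans hvκ) hvκ).mp hball]
    exact mem_sphericalCap.mpr ⟨hp, hpv ▸ hcd⟩
  exact (mem_sphericalCap.mp hp').2.ne' hpv

/-- The point with coordinates `(m, n)` in the triangular lattice with origin `x` and side `d`. -/
noncomputable def triangularLattice (x : EuclideanSpace ℝ (Fin 2)) (d : ℝ) (m n : ℤ) :
    EuclideanSpace ℝ (Fin 2) :=
  x + d • !₂[(m : ℝ) + n / 2, n * √3 / 2]

theorem dist_triangularLattice {x : EuclideanSpace ℝ (Fin 2)} {d : ℝ} (hd : 0 ≤ d)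
    (m n m' n' : ℤ) :
    dist (triangularLattice x d m n) (triangularLattice x d m' n') =
      d * √(((m - m') ^ 2 + (m - m') * (n - n') + (n - n') ^ 2 : ℤ) : ℝ) := by
  rw [triangularLattice, triangularLattice, dist_add_left, dist_smul₀, Real.norm_of_nonneg hd,
    EuclideanSpace.dist_eq]
  congr 2
  simp only [Fin.sum_univ_two, Real.dist_eq, sq_abs, Matrix.cons_val]
  push_cast
  linear_combination ((n : ℝ) - n') ^ 2 / 4 * Real.sq_sqrt (zero_le_three (α := ℝ))

theorem triangularLattice_zero (x : EuclideanSpace ℝ (Fin 2)) (d : ℝ) :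
    triangularLattice x d 0 0 = x := by
  ext i
  fin_cases i <;> simp [triangularLattice]

theorem dist_triangularLattice_of_eq_one {x : EuclideanSpace ℝ (Fin 2)} {d : ℝ} (hd : 0 ≤ d)
    {m n m' n' : ℤ} (h : (m - m') ^ 2 + (m - m') * (n - n') + (n - n') ^ 2 = 1) :
    dist (triangularLattice x d m n) (triangularLattice x d m' n') = d := by
  rw [dist_triangularLattice hd, h, Int.cast_one, Real.sqrt_one, mul_one]

theorem triangularLattice_ne {x : EuclideanSpace ℝ (Fin 2)} {d : ℝ} (hd : 0 < d)
    {m n m' n' : ℤ} (h : 0 < (m - m') ^ 2 + (m - m') * (n - n') + (n - n') ^ 2) :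
    triangularLattice x d m n ≠ triangularLattice x d m' n' := by
  rw [← dist_pos, dist_triangularLattice hd.le]
  have : (0 : ℝ) < ((m - m') ^ 2 + (m - m') * (n - n') + (n - n') ^ 2 : ℤ) := by exact_mod_cast h
  positivity

/-- A continuous injection on a plane set `V` that sends two tangent discs of equal radii to caps
of equal heights sends them to tangent caps. -/
theorem inner_centers_of_tangent_balls
    {V : Set (EuclideanSpace ℝ (Fin 2))} {ψ : EuclideanSpace ℝ (Fin 2) → EuclideanSpace ℝ (Fin 3)}
    (hψ : ContinuousOn ψ V) (hinj : Set.InjOn ψ V) {q q' : EuclideanSpace ℝ (Fin 2)} {r c : ℝ}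
    {v w : EuclideanSpace ℝ (Fin 3)} (hr : 0 < r) (hv : ‖v‖ = 1) (hw : ‖w‖ = 1)
    (hq : closedBall q r ⊆ V) (hq' : closedBall q' r ⊆ V) (hqv : ψ '' ball q r = sphericalCap v c)
    (hqw : ψ '' ball q' r = sphericalCap w c) (hdist : dist q q' = 2 * r) :
    ⟪v, w⟫ = 2 * c ^ 2 - 1 := by
  have hclosure : ∀ {q z : EuclideanSpace ℝ (Fin 2)} {u : EuclideanSpace ℝ (Fin 3)},
      closedBall q r ⊆ V → ψ '' ball q r = sphericalCap u c → z ∈ closedBall q r →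
      ‖ψ z‖ = 1 ∧ c ≤ ⟪ψ z, u⟫ := by
    intro q z u hq hqu hz
    have hcl : IsClosed {p : EuclideanSpace ℝ (Fin 3) | ‖p‖ = 1 ∧ c ≤ ⟪p, u⟫} :=
      (isClosed_eq (f := fun p => ‖p‖) (g := fun _ => 1) (by fun_prop) (by fun_prop)).inter
        (isClosed_le (f := fun _ => c) (g := fun p => ⟪p, u⟫) (by fun_prop) (by fun_prop))
    rw [← closure_ball q hr.ne'] at hz hq
    have hmem := (hψ.mono hq).image_closure (Set.mem_image_of_mem ψ hz)
    rw [hqu] at hmem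
    have hsub : sphericalCap u c ⊆ {p | ‖p‖ = 1 ∧ c ≤ ⟪p, u⟫} :=
      fun p hp => ⟨(mem_sphericalCap.mp hp).1, hp.2.le⟩
    exact closure_minimal hsub hcl hmem
  have hmid : midpoint ℝ q q' ∈ closedBall q r := by
    rw [mem_closedBall, dist_midpoint_left, hdist, Real.norm_ofNat]; linarith
  have hmid' : midpoint ℝ q q' ∈ closedBall q' r := by
    rw [mem_closedBall, dist_midpoint_right, hdist, Real.norm_ofNat]; linarith
  obtain ⟨hp, hpv⟩ := hclosure hq hqv hmid
  refine inner_centers_of_tangent_caps hv hw ?_ hp hpv (hclosure hq' hqw hmid').2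
  rw [← hqv, ← hqw]
  have hdisj : Disjoint (ball q r) (ball q' r) := ball_disjoint_ball (by linarith)
  rw [Set.disjoint_iff_inter_eq_empty, ← hinj.image_inter (ball_subset_closedBall.trans hq)
    (ball_subset_closedBall.trans hq'), hdisj.inter_eq, Set.image_empty]

/-- No map projection sends all spherical caps to Euclidean discs while preserving
equality of areas (so no map projection preserves the Reock score ordering). -/
theorem no_cap_to_disc_area_preserving_projection :
    ¬ ∃ (U : Set (EuclideanSpace ℝ (Fin 3))) (V : Set (EuclideanSpace ℝ (Fin 2)))
        (φ : EuclideanSpace ℝ (Fin 3) → EuclideanSpace ℝ (Fin 2))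
        (ψ : EuclideanSpace ℝ (Fin 2) → EuclideanSpace ℝ (Fin 3)),
      U.Nonempty ∧
      (∃ G : Set (EuclideanSpace ℝ (Fin 3)), IsOpen G ∧
        U = sphere (0 : EuclideanSpace ℝ (Fin 3)) 1 ∩ G) ∧
      IsOpen V ∧ φ '' U = V ∧ ψ '' V = U ∧
      ContinuousOn φ U ∧ ContinuousOn ψ V ∧
      (∀ p ∈ U, ψ (φ p) = p) ∧ (∀ q ∈ V, φ (ψ q) = q) ∧
      -- (i) caps are sent to open discs, and open discs are sent back to caps
      (∀ κ : Set (EuclideanSpace ℝ (Fin 3)), IsSphericalCap κ → κ ⊆ U →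
        ∃ (x : EuclideanSpace ℝ (Fin 2)) (r : ℝ), 0 < r ∧ φ '' κ = ball x r) ∧
      (∀ (x : EuclideanSpace ℝ (Fin 2)) (r : ℝ), 0 < r → ball x r ⊆ V →
        IsSphericalCap (ψ '' ball x r)) ∧
      -- (ii) equality of areas is preserved inside some cap
      (∃ κ₀ : Set (EuclideanSpace ℝ (Fin 3)), IsSphericalCap κ₀ ∧ κ₀.Nonempty ∧
        κ₀ ⊆ U ∧
        (∀ A B : Set (EuclideanSpace ℝ (Fin 3)), A ⊆ κ₀ → B ⊆ κ₀ →
          MeasurableSet A → MeasurableSet B → μH[2] A = μH[2] B →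
          volume (φ '' A) = volume (φ '' B)) ∧
        (∀ A' B' : Set (EuclideanSpace ℝ (Fin 2)), A' ⊆ φ '' κ₀ → B' ⊆ φ '' κ₀ →
          MeasurableSet A' → MeasurableSet B' → volume A' = volume B' →
          μH[2] (ψ '' A') = μH[2] (ψ '' B'))) := by
  rintro ⟨U, V, φ, ψ, -, -, -, hφU, -, -, hψ, hψφ, hφψ, hdisc, hcap, κ₀, hκ₀, -, hκ₀U, harea, -⟩
  obtain ⟨x, R, hR, hx⟩ := hdisc κ₀ hκ₀ hκ₀U
  have hxV : ball x R ⊆ V := hx ▸ hφU ▸ Set.image_mono hκ₀U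
  have hφinj : Set.InjOn φ U := fun p hp p' hp' h => by rw [← hψφ p hp, h, hψφ p' hp']
  have hψinj : Set.InjOn ψ V := fun q hq q' hq' h => by rw [← hφψ q hq, h, hφψ q' hq']
  have hψball : ∀ {q}, ball q (R / 4) ⊆ ball x R → ψ '' ball q (R / 4) ⊆ κ₀ := by
    rintro q hq _ ⟨z, hz, rfl⟩
    obtain ⟨p, hp, rfl⟩ := hx.symm ▸ hq hz
    rwa [hψφ p (hκ₀U hp)]
  have hφψball : ∀ {q}, ball q (R / 4) ⊆ ball x R → φ '' (ψ '' ball q (R / 4)) = ball q (R / 4) :=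
    fun {q} hq => by
      rw [Set.image_image, Set.image_congr fun z hz => hφψ z (hxV (hq hz)), Set.image_id']
  have hcap' : ∀ q, ball q (R / 4) ⊆ ball x R → ∃ v c, ‖v‖ = 1 ∧ -1 < c ∧ c < 1 ∧
      ψ '' ball q (R / 4) = sphericalCap v c :=
    fun q hq => hcap q (R / 4) (by positivity) (hq.trans hxV)
  choose! v c hv hc₁ hc₂ hvc using hcap'
  have hheight : ∀ {q q'}, ball q (R / 4) ⊆ ball x R → ball q' (R / 4) ⊆ ball x R →
      c q' ≤ c q := fun {q q'} hq hq' =>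
    height_le_of_image_eq_ball (hφinj.mono hκ₀U) (fun κ h h' => hdisc κ h (h'.trans hκ₀U)) harea
      (hv q hq) (hv q' hq') (hc₁ q hq) (hc₂ q' hq') (by positivity : 0 < R / 4)
      (hvc q hq ▸ hψball hq) (hvc q' hq' ▸ hψball hq') (hvc q hq ▸ hφψball hq)
      (hvc q' hq' ▸ hφψball hq')
  have hx₀ : ball x (R / 4) ⊆ ball x R := ball_subset_ball (by linarith)
  replace hvc : ∀ q, ball q (R / 4) ⊆ ball x R → ψ '' ball q (R / 4) = sphericalCap (v q) (c x) :=
    fun q hq => by rw [hvc q hq, (hheight hx₀ hq).antisymm (hheight hq hx₀)]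
  set P := triangularLattice x (R / 2) with hP
  have hP₀ : P 0 0 = x := triangularLattice_zero x (R / 2)
  have hclosed : ∀ m n : ℤ, m ^ 2 + m * n + n ^ 2 ≤ 1 → closedBall (P m n) (R / 4) ⊆ ball x R := by
    intro m n h
    refine closedBall_subset_ball' ?_
    have hdist := dist_triangularLattice (x := x) (by positivity : 0 ≤ R / 2) m n 0 0
    rw [← hP, hP₀] at hdist
    have : √(((m - 0) ^ 2 + (m - 0) * (n - 0) + (n - 0) ^ 2 : ℤ) : ℝ) ≤ 1 := by
      rw [Real.sqrt_le_one]
      exact_mod_cast by simpa using h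
    nlinarith
  have hball : ∀ m n : ℤ, m ^ 2 + m * n + n ^ 2 ≤ 1 → ball (P m n) (R / 4) ⊆ ball x R :=
    fun m n h => ball_subset_closedBall.trans (hclosed m n h)
  have hnorm : ∀ m n : ℤ, m ^ 2 + m * n + n ^ 2 ≤ 1 → ‖v (P m n)‖ = 1 :=
    fun m n h => hv _ (hball m n h)
  have hinner : ∀ m n m' n' : ℤ, m ^ 2 + m * n + n ^ 2 ≤ 1 → m' ^ 2 + m' * n' + n' ^ 2 ≤ 1 →
      (m - m') ^ 2 + (m - m') * (n - n') + (n - n') ^ 2 = 1 →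
      ⟪v (P m n), v (P m' n')⟫ = 2 * c x ^ 2 - 1 := fun m n m' n' h h' h'' =>
    inner_centers_of_tangent_balls hψ hψinj (by positivity : 0 < R / 4) (hnorm m n h)
      (hnorm m' n' h') ((hclosed m n h).trans hxV) ((hclosed m' n' h').trans hxV)
      (hvc _ (hball m n h)) (hvc _ (hball m' n' h'))
      ((dist_triangularLattice_of_eq_one (by positivity) h'').trans (by ring))
  have hne : ∀ m n m' n' : ℤ, m ^ 2 + m * n + n ^ 2 ≤ 1 → m' ^ 2 + m' * n' + n' ^ 2 ≤ 1 →
      0 < (m - m') ^ 2 + (m - m') * (n - n') + (n - n') ^ 2 → v (P m n) ≠ v (P m' n') := by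
    intro m n m' n' h h' h'' heq
    refine triangularLattice_ne (by positivity : 0 < R / 2) h'' (eq_of_ball_subset_ball
      (by positivity : 0 < R / 4) ?_ : P m n = P m' n')
    rw [← hφψball (hball m n h), hvc _ (hball m n h), heq, ← hvc _ (hball m' n' h'),
      hφψball (hball m' n' h')]
  refine not_equilateral_hexagon (a := 2 * c x ^ 2 - 1) (o := v (P 0 0)) (v₁ := v (P 1 0))
    (v₂ := v (P 0 1)) (v₃ := v (P (-1) 1)) (v₄ := v (P (-1) 0)) (v₅ := v (P 0 (-1)))
    (v₆ := v (P 1 (-1))) ?_ ?_ ?_ ?_ ?_ ?_ ?_ ?_ ?_ ?_ ?_ ?_ ?_ ?_ ?_ ?_ ?_ ?_ ?_ ?_ ?_ ?_ ?_ ?_ ?_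
    ?_ ?_
  all_goals first
    | exact hnorm _ _ (by norm_num)
    | exact hinner _ _ _ _ (by norm_num) (by norm_num) (by norm_num)
    | exact hne _ _ _ _ (by norm_num) (by norm_num) (by norm_num)
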